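/- The relation ≺ is an auxiliary relation for ≼ on K(X,Γ) (a ≺ b implies a ≼ b; a ≼ b, b ≺ c, c ≼ d imply a ≺ d; and the empty tuple is ≺ every element), and K(X,Γ) satisfies (W1), (W2), (W3) and (W4) with respect to ≺: (W1) for every a there is a sequence (a_k) with a_k ≺ a, a_k ≺ a_{k+1}, and every b ≺ a satisfies b ≺ a_k for some k; (W2) every a is a supremum of {b : b ≺ a} with respect to ≼; (W3) a' ≺ a and b' ≺ b imply a' + b' ≺ a + b; (W4) a ≺ b + c implies there exist b' ≺ b, c' ≺ c with a ≺ b' + c'. -/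

import Mathlib

open Pointwise TopologicalSpace

/-- The dynamical subequivalence relation `a ≼ b` on tuples (lists) of open subsets of `X`:
for every choice of compact sets `F i ⊆ a.get i` there are, for each `i`, finitely many
open sets `U i j` covering `F i`, group elements `s i j` and indices `k i j` such that
`s i j • U i j ⊆ b.get (k i j)` and the translates landing in the same component are
pairwise disjoint. -/
def DynSubeq (Γ : Type*) [Group Γ] {X : Type*} [TopologicalSpace X] [MulAction Γ X]
    (a b : List (Opens X)) : Prop :=
  ∀ F : Fin a.length → Set X,
    (∀ i, IsCompact (F i)) → (∀ i, F i ⊆ (a.get i : Set X)) →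
    ∃ (J : Fin a.length → ℕ)
      (U : (i : Fin a.length) → Fin (J i) → Set X)
      (s : (i : Fin a.length) → Fin (J i) → Γ)
      (k : (i : Fin a.length) → Fin (J i) → Fin b.length),
      (∀ i j, IsOpen (U i j)) ∧
      (∀ i, F i ⊆ ⋃ j, U i j) ∧
      (∀ i j, s i j • U i j ⊆ (b.get (k i j) : Set X)) ∧
      (∀ (i : Fin a.length) (j : Fin (J i)) (i' : Fin a.length) (j' : Fin (J i')),
        (i.val, j.val) ≠ (i'.val, j'.val) → k i j = k i' j' →
        Disjoint (s i j • U i j) (s i' j' • U i' j'))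

/-- The way-below relation `a ≪ b` on tuples of open subsets of `X`: the tuples have the
same length and each entry of `a` has compact closure contained in the corresponding
entry of `b`. -/
def DynWB {X : Type*} [TopologicalSpace X] (a b : List (Opens X)) : Prop :=
  ∃ h : a.length = b.length, ∀ i : Fin a.length,
    IsCompact (closure ((a.get i) : Set X)) ∧
    closure ((a.get i) : Set X) ⊆ ((b.get (Fin.cast h i)) : Set X)

/-- The auxiliary relation `a ≺ b`: there is `c` with `a ≼ c ≪ b`. -/
def DynAux (Γ : Type*) [Group Γ] {X : Type*} [TopologicalSpace X] [MulAction Γ X]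
    (a b : List (Opens X)) : Prop :=
  ∃ c : List (Opens X), DynSubeq Γ a c ∧ DynWB c b

open Set

/-- The relation underlying `DynSubeq`, for families of open sets over arbitrary index types:
all the covering sets `U j` are indexed by one finite type, `p j` being the index of the
compact set that `U j` helps to cover. -/
def FamSubeq (Γ : Type*) [Group Γ] {X I K : Type*} [TopologicalSpace X] [MulAction Γ X]
    (a : I → Opens X) (b : K → Opens X) : Prop :=
  ∀ F : I → Set X, (∀ i, IsCompact (F i)) → (∀ i, F i ⊆ (a i : Set X)) →
    ∃ (ι : Type) (_ : Finite ι) (p : ι → I) (U : ι → Set X) (s : ι → Γ) (k : ι → K),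
      (∀ j, IsOpen (U j)) ∧
      (∀ i, ∀ x ∈ F i, ∃ j, p j = i ∧ x ∈ U j) ∧
      (∀ j, s j • U j ⊆ (b (k j) : Set X)) ∧
      (∀ j j', j ≠ j' → k j = k j' → Disjoint (s j • U j) (s j' • U j'))

section Families

variable {Γ X : Type*} [Group Γ] [TopologicalSpace X] [MulAction Γ X]
variable {I I' K K' L : Type*}

theorem dynSubeq_iff_famSubeq {a b : List (Opens X)} :
    DynSubeq Γ a b ↔ FamSubeq Γ a.get b.get := by
  constructor
  · intro h F hF hFa
    obtain ⟨J, U, s, k, hU, hcov, hsub, hdisj⟩ := h F hF hFa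
    refine ⟨Σ i, Fin (J i), inferInstance, Sigma.fst, fun j => U j.1 j.2, fun j => s j.1 j.2,
      fun j => k j.1 j.2, fun j => hU _ _, fun i x hx => ?_, fun j => hsub _ _, ?_⟩
    · obtain ⟨j, hj⟩ := mem_iUnion.1 (hcov i hx)
      exact ⟨⟨i, j⟩, rfl, hj⟩
    · rintro ⟨i, j⟩ ⟨i', j'⟩ hne hk
      refine hdisj i j i' j' (fun heq => hne ?_) hk
      obtain ⟨h₁, h₂⟩ := Prod.mk.inj heq
      obtain rfl := Fin.ext h₁
      obtain rfl := Fin.ext h₂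
      rfl
  · intro h F hF hFa
    obtain ⟨ι, _, p, U, s, k, hU, hcov, hsub, hdisj⟩ := h F hF hFa
    let e : ∀ i, {j // p j = i} ≃ Fin (Nat.card {j // p j = i}) :=
      fun i => Finite.equivFin _
    refine ⟨fun i => Nat.card {j // p j = i}, fun i j => U ((e i).symm j),
      fun i j => s ((e i).symm j), fun i j => k ((e i).symm j), fun i j => hU _,
      fun i x hx => ?_, fun i j => hsub _, fun i j i' j' hne hk => hdisj _ _ ?_ hk⟩
    · obtain ⟨j, hj, hxj⟩ := hcov i x hx
      exact mem_iUnion.2 ⟨e i ⟨j, hj⟩, by simpa using hxj⟩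
    · intro heq
      obtain rfl : i = i' :=
        ((e i).symm j).2.symm.trans ((congrArg p heq).trans ((e i').symm j').2)
      exact hne (by rw [(e i).symm.injective (Subtype.ext heq)])

theorem FamSubeq.of_comp_equiv {a : I → Opens X} {b : K → Opens X} (e : I' ≃ I) (f : K' ≃ K)
    (h : FamSubeq Γ (a ∘ e) (b ∘ f)) : FamSubeq Γ a b := by
  intro F hF hFa
  obtain ⟨ι, hι, p, U, s, k, hU, hcov, hsub, hdisj⟩ :=
    h (F ∘ e) (fun i => hF _) (fun i => hFa _)
  refine ⟨ι, hι, e ∘ p, U, s, f ∘ k, hU, fun i x hx => ?_, hsub,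
    fun j j' hne hk => hdisj j j' hne (f.injective hk)⟩
  obtain ⟨j, hj, hxj⟩ := hcov (e.symm i) x (by simpa using hx)
  exact ⟨j, by simp [hj], hxj⟩

theorem FamSubeq.sumElim {a : I → Opens X} {b : K → Opens X} {a' : I' → Opens X}
    {b' : K' → Opens X} (h : FamSubeq Γ a b) (h' : FamSubeq Γ a' b') :
    FamSubeq Γ (Sum.elim a a') (Sum.elim b b') := by
  intro F hF hFa
  obtain ⟨ι, _, p, U, s, k, hU, hcov, hsub, hdisj⟩ :=
    h (F ∘ Sum.inl) (fun i => hF _) (fun i => hFa (.inl i))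
  obtain ⟨ι', _, p', U', s', k', hU', hcov', hsub', hdisj'⟩ :=
    h' (F ∘ Sum.inr) (fun i => hF _) (fun i => hFa (.inr i))
  refine ⟨ι ⊕ ι', inferInstance, Sum.map p p', Sum.elim U U', Sum.elim s s', Sum.map k k',
    ?_, ?_, ?_, ?_⟩
  · rintro (j | j)
    exacts [hU j, hU' j]
  · rintro (i | i) x hx
    · obtain ⟨j, hj, hxj⟩ := hcov i x hx
      exact ⟨.inl j, congrArg Sum.inl hj, hxj⟩
    · obtain ⟨j, hj, hxj⟩ := hcov' i x hx
      exact ⟨.inr j, congrArg Sum.inr hj, hxj⟩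
  · rintro (j | j)
    exacts [hsub j, hsub' j]
  · rintro (j | j) (j' | j') hne hk
    · exact hdisj j j' (fun e => hne (congrArg _ e)) (Sum.inl_injective hk)
    · cases hk
    · cases hk
    · exact hdisj' j j' (fun e => hne (congrArg _ e)) (Sum.inr_injective hk)

/-- Compact sets covered by finitely many open sets `U j` are already covered by compact
sets contained in the `U j`. -/
theorem exists_compact_shrinking [T2Space X] {ι : Type} [Finite ι] {F : I → Set X}
    (hF : ∀ i, IsCompact (F i)) (p : ι → I) {U : ι → Set X} (hU : ∀ j, IsOpen (U j))
    (hcov : ∀ i, ∀ x ∈ F i, ∃ j, p j = i ∧ x ∈ U j) :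
    ∃ C : ι → Set X, (∀ j, IsCompact (C j)) ∧ (∀ j, C j ⊆ U j) ∧
      ∀ i, ∀ x ∈ F i, ∃ j, p j = i ∧ x ∈ C j := by
  classical
  have := Fintype.ofFinite ι
  have key (i : I) := (hF i).finite_compact_cover (Finset.univ.filter (p · = i)) U
    (fun j _ => hU j) (fun x hx => by
      obtain ⟨j, hj, hxj⟩ := hcov i x hx
      simp only [mem_iUnion]
      exact ⟨j, by simpa using hj, hxj⟩)
  choose C hC hCU hFC using key
  refine ⟨fun j => C (p j) j, fun j => hC _ _, fun j => hCU _ _, fun i x hx => ?_⟩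
  rw [hFC i] at hx
  simp only [mem_iUnion, Finset.mem_filter, Finset.mem_univ, true_and] at hx
  obtain ⟨j, rfl, hxj⟩ := hx
  exact ⟨j, rfl, hxj⟩

theorem FamSubeq.trans [T2Space X] [ContinuousConstSMul Γ X] {a : I → Opens X} {b : K → Opens X}
    {c : L → Opens X} (hab : FamSubeq Γ a b) (hbc : FamSubeq Γ b c) : FamSubeq Γ a c := by
  intro F hF hFa
  obtain ⟨ι, _, p, U, s, k, hU, hcov, hsub, hdisj⟩ := hab F hF hFa
  obtain ⟨C, hC, hCU, hFC⟩ := exists_compact_shrinking hF p hU hcov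
  obtain ⟨κ, _, q, W, t, l, hW, hcovW, hsubW, hdisjW⟩ :=
    hbc (fun i => ⋃ j : {j // k j = i}, s j • C j)
      (fun i => isCompact_iUnion fun j => (hC j).smul (s j))
      (by
        intro i
        refine iUnion_subset ?_
        rintro ⟨j, rfl⟩
        exact (smul_set_mono (hCU j)).trans (hsub j))
  have himage (j : ι) (m : κ) :
      (t m * s j) • (U j ∩ (s j)⁻¹ • W m) = t m • (s j • U j ∩ W m) := by
    rw [mul_smul, smul_set_inter (a := s j), smul_inv_smul]
  refine ⟨{r : ι × κ // k r.1 = q r.2}, inferInstance, fun r => p r.1.1,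
    fun r => U r.1.1 ∩ (s r.1.1)⁻¹ • W r.1.2, fun r => t r.1.2 * s r.1.1, fun r => l r.1.2,
    fun r => (hU _).inter ((hW _).smul _), fun i x hx => ?_, fun r => ?_, ?_⟩
  · obtain ⟨j, hj, hxj⟩ := hFC i x hx
    obtain ⟨m, hm, hxm⟩ := hcovW (k j) (s j • x)
      (mem_iUnion.2 ⟨⟨j, rfl⟩, smul_mem_smul_set hxj⟩)
    exact ⟨⟨(j, m), hm.symm⟩, hj, hCU j hxj, mem_inv_smul_set_iff.2 hxm⟩
  · rw [himage]
    exact (smul_set_mono inter_subset_right).trans (hsubW _)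
  · rintro ⟨⟨j, m⟩, hjm⟩ ⟨⟨j', m'⟩, hjm'⟩ hne hl
    simp only [himage] at hjm hjm' hl ⊢
    by_cases hm : m = m'
    · subst hm
      rw [disjoint_smul_set]
      refine (hdisj j j' ?_ (hjm.trans hjm'.symm)).mono inter_subset_left inter_subset_left
      rintro rfl
      exact hne rfl
    · exact (hdisjW m m' hm hl).mono (smul_set_mono inter_subset_right)
        (smul_set_mono inter_subset_right)

theorem famSubeq_of_le [Finite I] {a b : I → Opens X} (h : a ≤ b) : FamSubeq Γ a b := by
  intro F _ hFa
  obtain ⟨n, ⟨e⟩⟩ := Finite.exists_equiv_fin I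
  refine ⟨Fin n, inferInstance, e.symm, fun j => a (e.symm j), fun _ => 1, e.symm,
    fun j => (a _).isOpen, fun i x hx => ⟨e i, by simp, by simpa using hFa i hx⟩,
    fun j => by simpa using h (e.symm j),
    fun j j' hne hk => absurd (e.symm.injective hk) hne⟩

/-- If `c' ≪ c ≼ d` then `c' ≼ d' ≪ d` for some `d'`. -/
theorem FamSubeq.exists_wayBelow [T2Space X] [LocallyCompactSpace X] [ContinuousConstSMul Γ X]
    {c c' : I → Opens X} {d : K → Opens X} (hcd : FamSubeq Γ c d)
    (hcomp : ∀ i, IsCompact (closure (c' i : Set X)))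
    (hcl : ∀ i, closure (c' i : Set X) ⊆ c i) :
    ∃ d' : K → Opens X, FamSubeq Γ c' d' ∧
      ∀ i, IsCompact (closure (d' i : Set X)) ∧ closure (d' i : Set X) ⊆ d i := by
  obtain ⟨ι, hι, p, U, s, k, hU, hcov, hsub, hdisj⟩ := hcd _ hcomp hcl
  obtain ⟨C, hC, hCU, hFC⟩ := exists_compact_shrinking hcomp p hU hcov
  choose V hV hCV hVU hVc using fun j =>
    exists_open_between_and_isCompact_closure (hC j) (hU j) (hCU j)
  have hclosure (i : K) : closure (⋃ j : {j // k j = i}, s j • V j) =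
      ⋃ j : {j // k j = i}, s j • closure (V j) := by
    rw [closure_iUnion_of_finite]
    simp only [closure_smul]
  refine ⟨fun i => ⟨⋃ j : {j // k j = i}, s j • V j,
    isOpen_iUnion fun j => (hV j).smul (s j)⟩, fun F _ hFa => ?_, fun i => ⟨?_, ?_⟩⟩
  · refine ⟨ι, hι, p, V, s, k, hV, fun i x hx => ?_,
      fun j => subset_iUnion (fun r : {r // k r = k j} => s r • V r) ⟨j, rfl⟩,
      fun j j' hne hk => (hdisj j j' hne hk).mono ?_ ?_⟩
    · obtain ⟨j, hj, hxj⟩ := hFC i x (subset_closure (hFa i hx))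
      exact ⟨j, hj, hCV j hxj⟩
    all_goals exact smul_set_mono (subset_closure.trans (hVU _))
  · exact hclosure i ▸ isCompact_iUnion fun j => (hVc j).smul (s j)
  · refine (hclosure i).subset.trans (iUnion_subset ?_)
    rintro ⟨j, rfl⟩
    exact (smul_set_mono (hVU j)).trans (hsub j)

end Families

/-- `U` has compact closure contained in `V`. -/
def CompactlyInside {X : Type*} [TopologicalSpace X] (U V : Opens X) : Prop :=
  IsCompact (closure (U : Set X)) ∧ closure (U : Set X) ⊆ V

section Lists

variable {Γ X : Type*} [Group Γ] [TopologicalSpace X] [MulAction Γ X]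

theorem CompactlyInside.le {U V : Opens X} (h : CompactlyInside U V) : U ≤ V :=
  subset_closure.trans h.2

theorem CompactlyInside.trans_le {U V W : Opens X} (h : CompactlyInside U V) (hVW : V ≤ W) :
    CompactlyInside U W :=
  ⟨h.1, h.2.trans hVW⟩

theorem IsCompact.exists_compactlyInside [T2Space X] [LocallyCompactSpace X] {F : Set X}
    (hF : IsCompact F) {V : Opens X} (hFV : F ⊆ V) :
    ∃ W : Opens X, F ⊆ W ∧ CompactlyInside W V := by
  obtain ⟨W, hW, hFW, hWV, hWc⟩ := exists_open_between_and_isCompact_closure hF V.isOpen hFV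
  exact ⟨⟨W, hW⟩, hFW, hWc, hWV⟩

theorem CompactlyInside.exists_between [T2Space X] [LocallyCompactSpace X] {U V : Opens X}
    (h : CompactlyInside U V) :
    ∃ W : Opens X, CompactlyInside U W ∧ CompactlyInside W V := by
  obtain ⟨W, hUW, hWV⟩ := h.1.exists_compactlyInside h.2
  exact ⟨W, ⟨h.1, hUW⟩, hWV⟩

theorem dynWB_iff_forall₂ {a b : List (Opens X)} :
    DynWB a b ↔ List.Forall₂ CompactlyInside a b := by
  rw [List.forall₂_iff_get]
  constructor
  · rintro ⟨hlen, h⟩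
    exact ⟨hlen, fun i hi _ => h ⟨i, hi⟩⟩
  · rintro ⟨hlen, h⟩
    exact ⟨hlen, fun i => h i i.2 (hlen ▸ i.2)⟩

theorem DynWB.append {a a' b b' : List (Opens X)} (h : DynWB a' a) (h' : DynWB b' b) :
    DynWB (a' ++ b') (a ++ b) := by
  rw [dynWB_iff_forall₂] at *
  exact List.rel_append h h'

theorem dynWB_ofFn {n : ℕ} {f g : Fin n → Opens X} (h : ∀ i, CompactlyInside (f i) (g i)) :
    DynWB (List.ofFn f) (List.ofFn g) := by
  refine ⟨by simp, fun i => ?_⟩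
  simpa using! h (Fin.cast (by simp) i)

theorem get_ofFn_comp_finCongr {n : ℕ} (f : Fin n → Opens X) :
    (List.ofFn f).get ∘ finCongr List.length_ofFn.symm = f := by
  funext i
  simp

theorem DynWB.exists_between [T2Space X] [LocallyCompactSpace X] {a b : List (Opens X)}
    (h : DynWB a b) : ∃ c, DynWB a c ∧ DynWB c b := by
  simp only [dynWB_iff_forall₂] at *
  induction h with
  | nil => exact ⟨[], .nil, .nil⟩
  | cons h _ ih =>
    obtain ⟨W, h₁, h₂⟩ := h.exists_between
    obtain ⟨c, hc₁, hc₂⟩ := ih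
    exact ⟨W :: c, .cons h₁ hc₁, .cons h₂ hc₂⟩

theorem DynSubeq.refl (a : List (Opens X)) : DynSubeq Γ a a :=
  dynSubeq_iff_famSubeq.2 (famSubeq_of_le le_rfl)

theorem DynSubeq.trans [T2Space X] [ContinuousConstSMul Γ X] {a b c : List (Opens X)}
    (h : DynSubeq Γ a b) (h' : DynSubeq Γ b c) : DynSubeq Γ a c :=
  dynSubeq_iff_famSubeq.2 ((dynSubeq_iff_famSubeq.1 h).trans (dynSubeq_iff_famSubeq.1 h'))

theorem DynWB.dynSubeq {a b : List (Opens X)} (h : DynWB a b) : DynSubeq Γ a b := by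
  obtain ⟨hlen, h⟩ := h
  exact dynSubeq_iff_famSubeq.2 <| .of_comp_equiv (Equiv.refl _) (finCongr hlen) <|
    famSubeq_of_le fun i => subset_closure.trans (h i).2

theorem DynWB.dynAux {a b : List (Opens X)} (h : DynWB a b) : DynAux Γ a b :=
  ⟨a, .refl a, h⟩

theorem DynAux.dynSubeq [T2Space X] [ContinuousConstSMul Γ X] {a b : List (Opens X)}
    (h : DynAux Γ a b) : DynSubeq Γ a b :=
  let ⟨_, hac, hcb⟩ := h
  hac.trans hcb.dynSubeq

theorem get_append_comp_sumEquiv (a b : List (Opens X)) :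
    (a ++ b).get ∘ (finSumFinEquiv.trans (finCongr List.length_append.symm)) =
      Sum.elim a.get b.get := by
  ext1 (i | i) <;> simp

theorem DynSubeq.append {a a' b b' : List (Opens X)} (h : DynSubeq Γ a' a)
    (h' : DynSubeq Γ b' b) : DynSubeq Γ (a' ++ b') (a ++ b) := by
  rw [dynSubeq_iff_famSubeq] at *
  refine .of_comp_equiv (finSumFinEquiv.trans (finCongr List.length_append.symm))
    (finSumFinEquiv.trans (finCongr List.length_append.symm)) ?_
  rw [get_append_comp_sumEquiv, get_append_comp_sumEquiv]
  exact h.sumElim h'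

theorem DynAux.append {a a' b b' : List (Opens X)} (h : DynAux Γ a' a) (h' : DynAux Γ b' b) :
    DynAux Γ (a' ++ b') (a ++ b) :=
  let ⟨c, hc, hca⟩ := h
  let ⟨d, hd, hdb⟩ := h'
  ⟨c ++ d, hc.append hd, hca.append hdb⟩

theorem DynAux.trans_dynSubeq [T2Space X] [LocallyCompactSpace X] [ContinuousConstSMul Γ X]
    {b c d : List (Opens X)} (h : DynAux Γ b c) (hcd : DynSubeq Γ c d) : DynAux Γ b d := by
  obtain ⟨c', hbc', hlen, hc'c⟩ := h
  have hcd' : FamSubeq Γ (c.get ∘ Fin.cast hlen) d.get :=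
    (FamSubeq.of_comp_equiv (Equiv.refl _) (finCongr hlen) (famSubeq_of_le le_rfl)).trans
      (dynSubeq_iff_famSubeq.1 hcd)
  obtain ⟨d', hc'd', hd'd⟩ := hcd'.exists_wayBelow (fun i => (hc'c i).1) (fun i => (hc'c i).2)
  refine ⟨List.ofFn d', hbc'.trans (dynSubeq_iff_famSubeq.2 ?_), ?_⟩
  · refine .of_comp_equiv (Equiv.refl _) (finCongr (List.length_ofFn (f := d')).symm) ?_
    rwa [get_ofFn_comp_finCongr]
  · simpa using dynWB_ofFn (g := d.get) hd'd

theorem exists_compactlyInside_exhaustion [T2Space X] [LocallyCompactSpace X]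
    [SecondCountableTopology X] (V : Opens X) :
    ∃ W : ℕ → Opens X, (∀ n, CompactlyInside (W n) V) ∧
      (∀ n, CompactlyInside (W n) (W (n + 1))) ∧
      ∀ U, CompactlyInside U V → ∃ n, CompactlyInside U (W n) := by
  have : LocallyCompactSpace V := V.isOpen.locallyCompactSpace
  let E : CompactExhaustion V := default
  have hE (n : ℕ) : IsCompact (Subtype.val '' E n : Set X) :=
    (E.isCompact n).image continuous_subtype_val
  let W : ℕ → Opens X := fun n =>
    ⟨Subtype.val '' interior (E n), V.isOpen.isOpenMap_subtype_val _ isOpen_interior⟩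
  have hWE (n : ℕ) : closure (W n : Set X) ⊆ Subtype.val '' E n :=
    closure_minimal (image_mono interior_subset) (hE n).isClosed
  have hc (n : ℕ) : IsCompact (closure (W n : Set X)) :=
    (hE n).of_isClosed_subset isClosed_closure (hWE n)
  refine ⟨W, fun n => ⟨hc n, (hWE n).trans (Subtype.coe_image_subset _ _)⟩,
    fun n => ⟨hc n, (hWE n).trans (image_mono (E.subset_interior_succ n))⟩, fun U hU => ?_⟩
  have hpre : IsCompact (Subtype.val ⁻¹' closure (U : Set X) : Set V) :=
    Topology.IsInducing.subtypeVal.isCompact_preimage_iff (by simpa using hU.2) |>.2 hU.1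
  obtain ⟨n, hn⟩ := E.exists_superset_of_isCompact hpre
  exact ⟨n + 1, hU.1, fun x hx => ⟨⟨x, hU.2 hx⟩, E.subset_interior_succ n (hn hx), rfl⟩⟩

theorem exists_dynWB_exhaustion [T2Space X] [LocallyCompactSpace X]
    [SecondCountableTopology X] (a : List (Opens X)) :
    ∃ f : ℕ → List (Opens X), (∀ n, DynWB (f n) a) ∧ (∀ n, DynWB (f n) (f (n + 1))) ∧
      ∀ b, DynWB b a → ∃ n, DynWB b (f n) := by
  choose W hWV hW hWex using exists_compactlyInside_exhaustion (X := X)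
  have hmono (V : Opens X) : Monotone (W V) := monotone_nat_of_le_succ fun n => (hW V n).le
  simp only [dynWB_iff_forall₂]
  refine ⟨fun n => a.map (W · n), fun n => ?_, fun n => ?_, fun b hb => ?_⟩
  · simpa [List.forall₂_same] using fun V _ => hWV V n
  · simpa [List.forall₂_same] using fun V _ => hW V n
  · induction hb with
    | nil => exact ⟨0, .nil⟩
    | @cons U V b a h _ ih =>
      obtain ⟨m, hm⟩ := hWex V U h
      obtain ⟨n, hn⟩ := ih
      refine ⟨max m n, .cons (hm.trans_le (hmono V (le_max_left m n))) ?_⟩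
      rw [List.forall₂_map_right_iff] at hn ⊢
      exact hn.imp fun _ V' h' => h'.trans_le (hmono V' (le_max_right m n))

theorem exists_dynWB (a : List (Opens X)) : ∃ c, DynWB c a := by
  refine ⟨a.map fun _ => ⊥, dynWB_iff_forall₂.2 ?_⟩
  rw [List.forall₂_map_left_iff, List.forall₂_same]
  simp [CompactlyInside]

theorem dynSubeq_nil (a : List (Opens X)) : DynSubeq Γ [] a :=
  fun _ _ _ => ⟨fun _ => 0, fun i => i.elim0, fun i => i.elim0, fun i => i.elim0,
    fun i => i.elim0, fun i => i.elim0, fun i => i.elim0, fun i => i.elim0⟩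

theorem dynSubeq_of_forall_dynWB [T2Space X] [LocallyCompactSpace X] {a c : List (Opens X)}
    (h : ∀ b, DynWB b a → DynSubeq Γ b c) : DynSubeq Γ a c := by
  rw [dynSubeq_iff_famSubeq]
  intro F hF hFa
  choose W hFW hW using fun i => (hF i).exists_compactlyInside (hFa i)
  have hWc : FamSubeq Γ W c.get := by
    refine .of_comp_equiv (finCongr (List.length_ofFn (f := W))) (Equiv.refl _) ?_
    have hget : W ∘ finCongr (List.length_ofFn (f := W)) = (List.ofFn W).get := by
      funext i
      simp [Fin.cast]
    rw [hget]
    exact dynSubeq_iff_famSubeq.1 (h (List.ofFn W) (by simpa using dynWB_ofFn (g := a.get) hW))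
  exact hWc F hF hFW

theorem DynAux.exists_append [T2Space X] [LocallyCompactSpace X] {a b c : List (Opens X)}
    (h : DynAux Γ a (b ++ c)) :
    ∃ b' c', DynAux Γ b' b ∧ DynAux Γ c' c ∧ DynAux Γ a (b' ++ c') := by
  obtain ⟨d, had, hd⟩ := h
  obtain ⟨e, hde, he⟩ := hd.exists_between
  rw [dynWB_iff_forall₂] at he
  have h₁ := List.forall₂_take_append e b c he
  have h₂ := List.forall₂_drop_append e b c he
  exact ⟨e.take b.length, e.drop b.length, (dynWB_iff_forall₂.2 h₁).dynAux,
    (dynWB_iff_forall₂.2 h₂).dynAux, d, had, by rwa [List.take_append_drop]⟩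

end Lists

/-- `≺` is an auxiliary relation for `≼` on `K(X, Γ)` and `K(X, Γ)` satisfies
(W1)-(W4) with respect to `≺`. -/
theorem dynK_is_W_semigroup {X : Type*} [TopologicalSpace X] [LocallyCompactSpace X] [T2Space X]
    [SecondCountableTopology X] {Γ : Type*} [Group Γ] [Countable Γ] [Infinite Γ]
    [MulAction Γ X] [ContinuousConstSMul Γ X] :
    (∀ a b : List (Opens X), DynAux Γ a b → DynSubeq Γ a b) ∧
    (∀ a b c d : List (Opens X),
      DynSubeq Γ a b → DynAux Γ b c → DynSubeq Γ c d → DynAux Γ a d) ∧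
    (∀ a : List (Opens X), DynAux Γ ([] : List (Opens X)) a) ∧
    (∀ a : List (Opens X), ∃ f : ℕ → List (Opens X), (∀ k : ℕ, DynAux Γ (f k) a) ∧
      (∀ k : ℕ, DynAux Γ (f k) (f (k + 1))) ∧
      ∀ b : List (Opens X), DynAux Γ b a → ∃ k : ℕ, DynAux Γ b (f k)) ∧
    (∀ a : List (Opens X), (∀ b : List (Opens X), DynAux Γ b a → DynSubeq Γ b a) ∧
      ∀ c : List (Opens X),
        (∀ b : List (Opens X), DynAux Γ b a → DynSubeq Γ b c) → DynSubeq Γ a c) ∧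
    (∀ a' a b' b : List (Opens X),
      DynAux Γ a' a → DynAux Γ b' b → DynAux Γ (a' ++ b') (a ++ b)) ∧
    (∀ a b c : List (Opens X), DynAux Γ a (b ++ c) →
      ∃ b' c' : List (Opens X), DynAux Γ b' b ∧ DynAux Γ c' c ∧ DynAux Γ a (b' ++ c')) := by
  refine ⟨fun a b h => h.dynSubeq, ?_, fun a => ?_, fun a => ?_,
    fun a => ⟨fun b h => h.dynSubeq, fun c h => dynSubeq_of_forall_dynWB fun b hb => h b hb.dynAux⟩,
    fun a' a b' b h h' => h.append h', fun a b c h => h.exists_append⟩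
  · rintro a b c d hab ⟨c', hbc', hc'⟩ hcd
    exact DynAux.trans_dynSubeq ⟨c', hab.trans hbc', hc'⟩ hcd
  · obtain ⟨c, hc⟩ := exists_dynWB a
    exact ⟨c, dynSubeq_nil c, hc⟩
  · obtain ⟨f, hfa, hf, hex⟩ := exists_dynWB_exhaustion a
    refine ⟨f, fun k => (hfa k).dynAux, fun k => (hf k).dynAux, ?_⟩
    rintro b ⟨c, hbc, hca⟩
    obtain ⟨k, hk⟩ := hex c hca
    exact ⟨k, c, hbc, hk⟩
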